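/- arXiv:2112.05397 — 4 statements merged into one kernel-verified Lean document; each statement's English description precedes it below -/
import Mathlib

section
/- Let ℓ > 0, let u be a tempered distribution on ℝ³ (a continuous linear functional on 𝓢(ℝ³, ℝ)), and let f : ℝ³ → ℝ be any iterated partial derivative (of any finite order, possibly order zero) of the Gaussian kernel E_ℓ(x) = (2ℓ√π)⁻³ · exp(−‖x‖²/(4ℓ²)). Suppose that for every x ∈ ℝ³, g_x is a Schwartz function on ℝ³ whose underlying function is y ↦ f(x − y). Then there exist a constant C ≥ 0 and a natural number s such that |u(g_x)| ≤ C · (1 + ‖x‖^s) for all x ∈ ℝ³. -/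
open MeasureTheory SchwartzMap

namespace SchwartzMap

variable {E F : Type*} [NormedAddCommGroup E] [NormedSpace ℝ E]
  [NormedAddCommGroup F] [NormedSpace ℝ F]

/-- The Schwartz seminorms of the translates of a Schwartz function grow at most polynomially. -/
theorem seminorm_compSubConstCLM_le (φ : SchwartzMap E F) (k n : ℕ) (x : E) :
    SchwartzMap.seminorm ℝ k n (compSubConstCLM ℝ x φ) ≤
      2 ^ (k - 1) *
        (SchwartzMap.seminorm ℝ k n φ + ‖x‖ ^ k * SchwartzMap.seminorm ℝ 0 n φ) := by
  refine seminorm_le_bound ℝ k n _ (by positivity) fun y => ?_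
  have hcomp : iteratedFDeriv ℝ n (compSubConstCLM ℝ x φ) y = iteratedFDeriv ℝ n φ (y - x) :=
    iteratedFDeriv_comp_sub n x y
  have hnorm : ‖y‖ ≤ ‖y - x‖ + ‖x‖ := by simpa using norm_add_le (y - x) x
  rw [hcomp]
  calc ‖y‖ ^ k * ‖iteratedFDeriv ℝ n φ (y - x)‖
      ≤ (2 ^ (k - 1) * (‖y - x‖ ^ k + ‖x‖ ^ k)) * ‖iteratedFDeriv ℝ n φ (y - x)‖ := by
        gcongr
        exact (pow_le_pow_left₀ (norm_nonneg y) hnorm k).trans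
          (add_pow_le (norm_nonneg _) (norm_nonneg _) k)
    _ = 2 ^ (k - 1) * (‖y - x‖ ^ k * ‖iteratedFDeriv ℝ n φ (y - x)‖ +
          ‖x‖ ^ k * ‖iteratedFDeriv ℝ n φ (y - x)‖) := by ring
    _ ≤ _ := by
        gcongr
        · exact le_seminorm ℝ k n φ (y - x)
        · exact norm_iteratedFDeriv_le_seminorm ℝ φ n (y - x)

/-- A tempered distribution evaluated at the translates of a fixed Schwartz function is bounded
by a polynomial in the translation. -/
theorem exists_abs_compSubConstCLM_le (u : SchwartzMap E F →L[ℝ] ℝ) (φ : SchwartzMap E F) :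
    ∃ (C : ℝ) (s : ℕ), 0 ≤ C ∧
      ∀ x : E, |u (compSubConstCLM ℝ x φ)| ≤ C * (1 + ‖x‖ ^ s) := by
  obtain ⟨t, K, -, hK⟩ := Seminorm.bound_of_continuous (schwartz_withSeminorms ℝ E F)
    ((normSeminorm ℝ ℝ).comp u.toLinearMap) (continuous_norm.comp u.continuous)
  let A : ℕ × ℕ → ℝ := fun i =>
    2 ^ (i.1 - 1) * (SchwartzMap.seminorm ℝ i.1 i.2 φ + SchwartzMap.seminorm ℝ 0 i.2 φ)
  refine ⟨K * ∑ i ∈ t, A i, t.sup Prod.fst, by positivity, fun x => ?_⟩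
  have hterm : ∀ i ∈ t, schwartzSeminormFamily ℝ E F i (compSubConstCLM ℝ x φ) ≤
      A i * (1 + ‖x‖ ^ t.sup Prod.fst) := by
    intro i hi
    have hpow : ‖x‖ ^ i.1 ≤ 1 + ‖x‖ ^ t.sup Prod.fst := by
      rcases le_total ‖x‖ 1 with hx | hx
      · exact (pow_le_one₀ (norm_nonneg x) hx).trans (le_add_of_nonneg_right (by positivity))
      · exact (pow_le_pow_right₀ hx (Finset.le_sup (f := Prod.fst) hi)).trans
          (le_add_of_nonneg_left zero_le_one)
    have hone : 1 ≤ 1 + ‖x‖ ^ t.sup Prod.fst := le_add_of_nonneg_right (by positivity)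
    calc schwartzSeminormFamily ℝ E F i (compSubConstCLM ℝ x φ)
        ≤ 2 ^ (i.1 - 1) * (SchwartzMap.seminorm ℝ i.1 i.2 φ +
            ‖x‖ ^ i.1 * SchwartzMap.seminorm ℝ 0 i.2 φ) :=
          seminorm_compSubConstCLM_le φ i.1 i.2 x
      _ ≤ 2 ^ (i.1 - 1) * ((1 + ‖x‖ ^ t.sup Prod.fst) * SchwartzMap.seminorm ℝ i.1 i.2 φ +
            (1 + ‖x‖ ^ t.sup Prod.fst) * SchwartzMap.seminorm ℝ 0 i.2 φ) := by
          gcongr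
          exact le_mul_of_one_le_left (apply_nonneg _ _) hone
      _ = A i * (1 + ‖x‖ ^ t.sup Prod.fst) := by ring
  calc |u (compSubConstCLM ℝ x φ)|
      ≤ K * t.sup (schwartzSeminormFamily ℝ E F) (compSubConstCLM ℝ x φ) :=
        hK (compSubConstCLM ℝ x φ)
    _ ≤ K * ∑ i ∈ t, schwartzSeminormFamily ℝ E F i (compSubConstCLM ℝ x φ) := by
        gcongr
        refine Seminorm.finset_sup_apply_le (Finset.sum_nonneg fun i _ => apply_nonneg _ _)
          fun i hi => ?_
        exact Finset.single_le_sum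
          (f := fun i => schwartzSeminormFamily ℝ E F i (compSubConstCLM ℝ x φ))
          (fun j _ => apply_nonneg _ _) hi
    _ ≤ K * ∑ i ∈ t, A i * (1 + ‖x‖ ^ t.sup Prod.fst) := by
        gcongr with i hi
        exact hterm i hi
    _ = K * (∑ i ∈ t, A i) * (1 + ‖x‖ ^ t.sup Prod.fst) := by
        rw [← Finset.sum_mul, mul_assoc]

end SchwartzMap

/-- Proposition 4 of the paper. If `u` is a tempered distribution on ℝ³ and
`f` is any iterated partial derivative (of any finite order `m`, along coordinate directions
`idx : Fin m → Fin 3`) of the Gaussian kernel `E_ℓ(x) = (2ℓ√π)⁻³ exp(−‖x‖²/(4ℓ²))`, and for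
each `x`, `g x` is the Schwartz function `y ↦ f (x − y)`, then `x ↦ u (g x)` is bounded by a
polynomial. -/
theorem static_field_derivatives_polynomially_bounded
    (ℓ : ℝ) (hℓ : 0 < ℓ)
    (u : SchwartzMap (EuclideanSpace ℝ (Fin 3)) ℝ →L[ℝ] ℝ)
    (m : ℕ) (idx : Fin m → Fin 3)
    (f : EuclideanSpace ℝ (Fin 3) → ℝ)
    (hf : ∀ x : EuclideanSpace ℝ (Fin 3),
      f x = iteratedFDeriv ℝ m
        (fun y : EuclideanSpace ℝ (Fin 3) =>
          ((2 * ℓ * Real.sqrt Real.pi) ^ 3)⁻¹ * Real.exp (-‖y‖ ^ 2 / (4 * ℓ ^ 2))) x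
        (fun i => EuclideanSpace.single (idx i) (1 : ℝ)))
    (g : EuclideanSpace ℝ (Fin 3) → SchwartzMap (EuclideanSpace ℝ (Fin 3)) ℝ)
    (hg : ∀ x y : EuclideanSpace ℝ (Fin 3), g x y = f (x - y)) :
    ∃ (C : ℝ) (s : ℕ), 0 ≤ C ∧
      ∀ x : EuclideanSpace ℝ (Fin 3), |u (g x)| ≤ C * (1 + ‖x‖ ^ s) := by
  obtain ⟨C, s, hC, hbound⟩ := exists_abs_compSubConstCLM_le u (g 0)
  refine ⟨C, s, hC, fun x => ?_⟩
  have htranslate : g x = compSubConstCLM ℝ x (g 0) := by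
    ext y
    rw [compSubConstCLM_apply, hg, hg, zero_sub, neg_sub]
  rw [htranslate]
  exact hbound x
end

section
/- Let n ≥ 1, let ψ ∈ 𝓢(ℝⁿ, ℝ) be a Schwartz function, and let s be a natural number. Then there exists a constant C ≥ 0 (depending only on ψ, s, and n) such that for every Schwartz function φ ∈ 𝓢(ℝⁿ, ℝ) and every natural number m with m ≤ s, sup_{x ∈ ℝⁿ} (1 + ‖x‖²)^{s/2} · ‖D^m(ψ ⋆ φ)(x)‖ ≤ C · ( sup_{z ∈ ℝⁿ} (1 + ‖z‖²)^{s/2} |φ(z)| + sup_{z ∈ ℝⁿ} |φ(z)| ), where (ψ ⋆ φ)(x) = ∫_{ℝⁿ} ψ(y) φ(x − y) dy and D^m denotes the m-th iterated (Fréchet) derivative. -/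
open MeasureTheory SchwartzMap

open scoped ContDiff in
/-- Derivatives of a convolution `∫ f y • g (x - y) dy` fall on `g`, when `f` is integrable and all
derivatives of `g` are bounded. -/
theorem iteratedFDeriv_integral_smul_comp_sub {E F : Type*}
    [NormedAddCommGroup E] [NormedSpace ℝ E] [MeasurableSpace E] [BorelSpace E]
    [SecondCountableTopology E] [NormedAddCommGroup F] [NormedSpace ℝ F] {μ : Measure E}
    {f : E → ℝ} {g : E → F} (hf : Integrable f μ) (hg : ContDiff ℝ ∞ g)
    (hbound : ∀ m : ℕ, ∃ C, ∀ x, ‖iteratedFDeriv ℝ m g x‖ ≤ C) (m : ℕ) (x : E) :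
    iteratedFDeriv ℝ m (fun x => ∫ y, f y • g (x - y) ∂μ) x =
      ∫ y, f y • iteratedFDeriv ℝ m g (x - y) ∂μ := by
  have hcont (m : ℕ) : Continuous (iteratedFDeriv ℝ m g) :=
    hg.continuous_iteratedFDeriv (mod_cast le_top)
  have hmeas (m : ℕ) (x : E) :
      AEStronglyMeasurable (fun y => f y • iteratedFDeriv ℝ m g (x - y)) μ :=
    hf.1.smul ((hcont m).comp (continuous_const.sub continuous_id)).aestronglyMeasurable
  have hint (m : ℕ) (x : E) : Integrable (fun y => f y • iteratedFDeriv ℝ m g (x - y)) μ := by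
    obtain ⟨C, hC⟩ := hbound m
    refine (hf.norm.mul_const C).mono' (hmeas m x) (.of_forall fun y => ?_)
    rw [norm_smul]
    exact mul_le_mul_of_nonneg_left (hC _) (norm_nonneg _)
  have hderiv (m : ℕ) (x : E) :
      HasFDerivAt (fun x => ∫ y, f y • iteratedFDeriv ℝ m g (x - y) ∂μ)
        (∫ y, f y • iteratedFDeriv ℝ (m + 1) g (x - y) ∂μ).curryLeft x := by
    obtain ⟨C, hC⟩ := hbound (m + 1)
    let L := continuousMultilinearCurryLeftEquiv ℝ (fun _ : Fin (m + 1) => E) F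
    have hL : L (∫ y, f y • iteratedFDeriv ℝ (m + 1) g (x - y) ∂μ) =
        ∫ y, L (f y • iteratedFDeriv ℝ (m + 1) g (x - y)) ∂μ :=
      (ContinuousLinearEquiv.integral_comp_comm (𝕜 := ℝ)
        (E := ContinuousMultilinearMap ℝ (fun _ : Fin (m + 1) => E) F)
        (F := E →L[ℝ] ContinuousMultilinearMap ℝ (fun _ : Fin m => E) F)
        L.toContinuousLinearEquiv _).symm
    change HasFDerivAt _ (L (∫ y, f y • iteratedFDeriv ℝ (m + 1) g (x - y) ∂μ)) x
    rw [hL]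
    refine hasFDerivAt_integral_of_dominated_of_fderiv_le
      (F' := fun x y => L (f y • iteratedFDeriv ℝ (m + 1) g (x - y)))
      (bound := fun y => ‖f y‖ * C) Filter.univ_mem
      (.of_forall (hmeas m)) (hint m x)
      (L.continuous.comp_aestronglyMeasurable (hmeas (m + 1) x))
      (.of_forall fun y x _ => ?_) (hf.norm.mul_const C) (.of_forall fun y x _ => ?_)
    · rw [L.norm_map, norm_smul]
      exact mul_le_mul_of_nonneg_left (hC _) (norm_nonneg _)
    · have hd : HasFDerivAt (iteratedFDeriv ℝ m g)
          (L (iteratedFDeriv ℝ (m + 1) g (x - y))) (x - y) :=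
        (hg.differentiable_iteratedFDeriv (mod_cast ENat.natCast_lt_top m) (x - y)).hasFDerivAt
      rw [map_smul]
      exact (hd.comp x ((hasFDerivAt_id x).sub_const y)).const_smul (f y)
  have hseries : HasFTaylorSeriesUpTo ∞ (fun x => ∫ y, f y • g (x - y) ∂μ)
      (fun x m => ∫ y, f y • iteratedFDeriv ℝ m g (x - y) ∂μ) :=
    { zero_eq := fun x =>
        ((continuousMultilinearCurryFin0 ℝ E F).toContinuousLinearEquiv.integral_comp_comm
          (fun y => f y • iteratedFDeriv ℝ 0 g (x - y))).symm
      fderiv := fun m _ x => hderiv m x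
      cont := fun m _ => continuous_iff_continuousAt.2 fun x => (hderiv m x).continuousAt }
  exact (hseries.eq_iteratedFDeriv (mod_cast le_top) x).symm

theorem one_add_norm_sq_rpow_half_le {E : Type*} [SeminormedAddCommGroup E] (s : ℕ) (x : E) :
    (1 + ‖x‖ ^ 2) ^ ((s : ℝ) / 2) ≤ (1 + ‖x‖) ^ s := by
  calc (1 + ‖x‖ ^ 2) ^ ((s : ℝ) / 2) ≤ ((1 + ‖x‖) ^ 2) ^ ((s : ℝ) / 2) := by
        gcongr
        nlinarith [norm_nonneg x]
    _ = (1 + ‖x‖) ^ s := by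
        rw [← Real.rpow_natCast (1 + ‖x‖) 2, ← Real.rpow_mul (by positivity),
          ← Real.rpow_natCast]
        congr 1
        push_cast
        ring

/-- Peetre's inequality. -/
theorem one_add_norm_add_sq_rpow_le {E : Type*} [SeminormedAddCommGroup E] {r : ℝ} (hr : 0 ≤ r)
    (x y : E) :
    (1 + ‖x + y‖ ^ 2) ^ r ≤ 2 ^ r * ((1 + ‖x‖ ^ 2) ^ r * (1 + ‖y‖ ^ 2) ^ r) := by
  rw [← Real.mul_rpow (by positivity) (by positivity),
    ← Real.mul_rpow (by positivity) (by positivity)]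
  refine Real.rpow_le_rpow (by positivity) ?_ hr
  have h : ‖x + y‖ ^ 2 ≤ (‖x‖ + ‖y‖) ^ 2 := by
    gcongr
    exact norm_add_le x y
  nlinarith [sq_nonneg (‖x‖ - ‖y‖), sq_nonneg (‖x‖ * ‖y‖)]

theorem SchwartzMap.integrable_one_add_norm_sq_rpow_mul_iteratedFDeriv {E F : Type*}
    [NormedAddCommGroup E] [NormedSpace ℝ E] [MeasurableSpace E] [BorelSpace E]
    [SecondCountableTopology E] [NormedAddCommGroup F] [NormedSpace ℝ F] {μ : Measure E}
    [μ.HasTemperateGrowth] (f : 𝓢(E, F)) (s m : ℕ) :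
    Integrable (fun x => (1 + ‖x‖ ^ 2) ^ ((s : ℝ) / 2) * ‖iteratedFDeriv ℝ m f x‖) μ := by
  have hcont : Continuous (iteratedFDeriv ℝ m f) :=
    (f.smooth ⊤).continuous_iteratedFDeriv (mod_cast le_top)
  have hw : Continuous fun x : E => (1 + ‖x‖ ^ 2) ^ ((s : ℝ) / 2) :=
    Continuous.rpow_const (by fun_prop) fun x => .inr (by positivity)
  refine Integrable.mono' (((f.integrable_pow_mul_iteratedFDeriv μ 0 m).add
    (f.integrable_pow_mul_iteratedFDeriv μ s m)).const_mul (2 ^ (s - 1)))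
    (hw.mul hcont.norm).aestronglyMeasurable (.of_forall fun x => ?_)
  rw [Real.norm_of_nonneg (by positivity)]
  calc (1 + ‖x‖ ^ 2) ^ ((s : ℝ) / 2) * ‖iteratedFDeriv ℝ m f x‖
      ≤ 2 ^ (s - 1) * (1 ^ s + ‖x‖ ^ s) * ‖iteratedFDeriv ℝ m f x‖ := by
        gcongr
        exact (one_add_norm_sq_rpow_half_le s x).trans
          (add_pow_le zero_le_one (norm_nonneg x) s)
    _ = _ := by
        simp only [Pi.add_apply]
        ring

theorem SchwartzMap.bddAbove_one_add_norm_sq_rpow_mul {E F : Type*}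
    [NormedAddCommGroup E] [NormedSpace ℝ E] [NormedAddCommGroup F] [NormedSpace ℝ F]
    (f : 𝓢(E, F)) (s : ℕ) :
    BddAbove (Set.range fun x => (1 + ‖x‖ ^ 2) ^ ((s : ℝ) / 2) * ‖f x‖) := by
  refine ⟨2 ^ s * (Finset.Iic (s, 0)).sup (fun m => SchwartzMap.seminorm ℝ m.1 m.2) f, ?_⟩
  rintro _ ⟨x, rfl⟩
  have h := SchwartzMap.one_add_le_sup_seminorm_apply (𝕜 := ℝ) (m := (s, 0)) le_rfl le_rfl f x
  rw [norm_iteratedFDeriv_zero] at h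
  exact (mul_le_mul_of_nonneg_right (one_add_norm_sq_rpow_half_le s x) (norm_nonneg _)).trans h

/-- seminorm estimate in the proof of Proposition A.8 of the paper. For a
fixed Schwartz `ψ` and natural `s` there is a constant `C ≥ 0` such that for every Schwartz
`φ` and every `m ≤ s`,
`sup_x (1+‖x‖²)^{s/2} ‖D^m(ψ ⋆ φ)(x)‖ ≤ C (sup_z (1+‖z‖²)^{s/2}|φ z| + sup_z |φ z|)`. -/
theorem convolution_seminorm_estimate
    (n : ℕ) (hn : 1 ≤ n)
    (ψ : SchwartzMap (EuclideanSpace ℝ (Fin n)) ℝ) (s : ℕ) :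
    ∃ C : ℝ, 0 ≤ C ∧
      ∀ (φ : SchwartzMap (EuclideanSpace ℝ (Fin n)) ℝ) (m : ℕ), m ≤ s →
        ∀ x : EuclideanSpace ℝ (Fin n),
          (1 + ‖x‖ ^ 2) ^ ((s : ℝ) / 2) * ‖iteratedFDeriv ℝ m
              (fun x : EuclideanSpace ℝ (Fin n) => ∫ y, ψ y * φ (x - y)) x‖ ≤
            C * ((⨆ z : EuclideanSpace ℝ (Fin n), (1 + ‖z‖ ^ 2) ^ ((s : ℝ) / 2) * |φ z|) +
              ⨆ z : EuclideanSpace ℝ (Fin n), |φ z|) := by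
  let w : EuclideanSpace ℝ (Fin n) → ℝ := fun x => (1 + ‖x‖ ^ 2) ^ ((s : ℝ) / 2)
  have hw (x) : 0 ≤ w x := by positivity
  let I : ℕ → ℝ := fun m => ∫ y, w y * ‖iteratedFDeriv ℝ m ψ y‖
  have hI (m) : 0 ≤ I m := integral_nonneg fun y => mul_nonneg (hw y) (norm_nonneg _)
  have hsum : 0 ≤ ∑ m ∈ Finset.range (s + 1), I m := Finset.sum_nonneg fun m _ => hI m
  refine ⟨2 ^ ((s : ℝ) / 2) * ∑ m ∈ Finset.range (s + 1), I m, by positivity,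
    fun φ m hm x => ?_⟩
  set A := ⨆ z : EuclideanSpace ℝ (Fin n), (1 + ‖z‖ ^ 2) ^ ((s : ℝ) / 2) * |φ z|
  have hA (z) : w z * |φ z| ≤ A := le_ciSup (φ.bddAbove_one_add_norm_sq_rpow_mul s) z
  have hA₀ : 0 ≤ A := Real.iSup_nonneg fun z => by positivity
  have hB₀ : 0 ≤ ⨆ z : EuclideanSpace ℝ (Fin n), |φ z| := Real.iSup_nonneg fun z => abs_nonneg _
  have hconv : (fun x => ∫ y, ψ y * φ (x - y)) = fun x => ∫ y, φ y • ψ (x - y) := by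
    funext x
    rw [← integral_sub_left_eq_self _ volume x]
    simp [mul_comm]
  rw [hconv, iteratedFDeriv_integral_smul_comp_sub φ.integrable (ψ.smooth ⊤)
    fun m => ⟨_, fun x => ψ.norm_iteratedFDeriv_le_seminorm ℝ m x⟩]
  have hint : Integrable fun y => w (x - y) * ‖iteratedFDeriv ℝ m ψ (x - y)‖ :=
    (ψ.integrable_one_add_norm_sq_rpow_mul_iteratedFDeriv s m).comp_sub_left x
  calc w x * ‖∫ y, φ y • iteratedFDeriv ℝ m ψ (x - y)‖
      = ‖∫ y, w x • φ y • iteratedFDeriv ℝ m ψ (x - y)‖ := by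
        rw [integral_smul, norm_smul, Real.norm_of_nonneg (hw x)]
    _ ≤ ∫ y, 2 ^ ((s : ℝ) / 2) * A * (w (x - y) * ‖iteratedFDeriv ℝ m ψ (x - y)‖) := by
        refine norm_integral_le_of_norm_le (hint.const_mul _) (.of_forall fun y => ?_)
        rw [norm_smul, norm_smul, Real.norm_of_nonneg (hw x), Real.norm_eq_abs]
        have hpeetre : w x ≤ 2 ^ ((s : ℝ) / 2) * (w (x - y) * w y) := by
          simpa using one_add_norm_add_sq_rpow_le (r := (s : ℝ) / 2) (by positivity) (x - y) y
        calc w x * (|φ y| * ‖iteratedFDeriv ℝ m ψ (x - y)‖)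
            ≤ 2 ^ ((s : ℝ) / 2) * (w (x - y) * w y) *
                (|φ y| * ‖iteratedFDeriv ℝ m ψ (x - y)‖) := by gcongr
          _ = 2 ^ ((s : ℝ) / 2) * (w y * |φ y|) *
                (w (x - y) * ‖iteratedFDeriv ℝ m ψ (x - y)‖) := by ring
          _ ≤ _ := by
              have := hw (x - y)
              gcongr
              exact hA y
    _ = 2 ^ ((s : ℝ) / 2) * I m * A := by
        rw [integral_const_mul,
          integral_sub_left_eq_self (fun y => w y * ‖iteratedFDeriv ℝ m ψ y‖) volume x]
        ring
    _ ≤ _ := by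
        gcongr
        · exact Finset.single_le_sum (fun m _ => hI m) (Finset.mem_range.2 (by omega))
        · exact le_add_of_nonneg_right hB₀
end

section
/- Let ℓ > 0 and let x ∈ ℝ³ with x ≠ 0. Then (2π)⁻³ · ∫_{ℝ³} (exp(−ℓ²‖k‖²) / ‖k‖²) · exp(i⟨k, x⟩) dk = (1/(4π‖x‖)) · Erf(‖x‖/(2ℓ)), where Erf(z) := (2/√π) ∫₀^z e^{−t²} dt is the error function, the integral on the left is a complex-valued Lebesgue integral (absolutely convergent), and ⟨·,·⟩ is the Euclidean inner product on ℝ³. -/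
open MeasureTheory RealInnerProductSpace

/-- The error function `Erf(z) = (2/√π) ∫₀^z e^{−t²} dt`. -/
noncomputable def Erf (z : ℝ) : ℝ :=
  (2 / Real.sqrt Real.pi) * ∫ t in (0 : ℝ)..z, Real.exp (-t ^ 2)

theorem rpow_pi_div_inv_sq {u : ℝ} (hu : 0 < u) :
    (Real.pi / (u ^ 2)⁻¹) ^ (3 / 2 : ℝ) = (Real.sqrt Real.pi * u) ^ 3 := by
  have h : Real.pi / (u ^ 2)⁻¹ = (Real.sqrt Real.pi * u) ^ (2 : ℝ) := by
    rw [Real.rpow_two, mul_pow, Real.sq_sqrt Real.pi_pos.le, div_inv_eq_mul]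
  rw [h, ← Real.rpow_mul (by positivity), ← Real.rpow_natCast]
  norm_num

/-- The Gaussian kernel `2 u⁻³ exp (-(r / u)²)`, the `u`-derivative of `exp (-(r / u)²) / r²`. -/
noncomputable def gaussianKernel (u r : ℝ) : ℝ :=
  2 * (u ^ 3)⁻¹ * Real.exp (-(u ^ 2)⁻¹ * r ^ 2)

theorem gaussianKernel_nonneg {u : ℝ} (hu : 0 < u) (r : ℝ) : 0 ≤ gaussianKernel u r := by
  unfold gaussianKernel
  positivity

theorem integrable_gaussianKernel_norm {u : ℝ} (hu : 0 < u) :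
    Integrable (fun k : EuclideanSpace ℝ (Fin 3) => gaussianKernel u ‖k‖) := by
  have h := GaussianFourier.integrable_cexp_neg_mul_sq_norm_add
    (b := (((u ^ 2)⁻¹ : ℝ) : ℂ)) (by rw [Complex.ofReal_re]; positivity) 0
    (0 : EuclideanSpace ℝ (Fin 3))
  refine (h.norm.const_mul (2 * (u ^ 3)⁻¹)).congr (.of_forall fun k => ?_)
  simp only [gaussianKernel, zero_mul, add_zero]
  rw [← Complex.norm_of_nonneg (Real.exp_nonneg _)]
  push_cast
  rfl

theorem integral_gaussianKernel_norm_mul_cexp {u : ℝ} (hu : 0 < u)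
    (x : EuclideanSpace ℝ (Fin 3)) :
    ∫ k : EuclideanSpace ℝ (Fin 3), (gaussianKernel u ‖k‖ : ℂ) *
        Complex.exp (Complex.I * ((⟪k, x⟫ : ℝ) : ℂ)) =
      ((2 * Real.sqrt Real.pi ^ 3 * Real.exp (-(‖x‖ / 2 * u) ^ 2) : ℝ) : ℂ) := by
  have h := GaussianFourier.integral_cexp_neg_mul_sq_norm_add_of_euclideanSpace
    (b := (((u ^ 2)⁻¹ : ℝ) : ℂ)) (by rw [Complex.ofReal_re]; positivity) Complex.I x
  have hpow : ((Real.pi : ℂ) / (((u ^ 2)⁻¹ : ℝ) : ℂ)) ^ ((Fintype.card (Fin 3) : ℂ) / 2) =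
      (((Real.sqrt Real.pi * u) ^ 3 : ℝ) : ℂ) := by
    rw [← rpow_pi_div_inv_sq hu, Complex.ofReal_cpow (by positivity)]
    simp
  rw [hpow] at h
  have hfun : ∀ k : EuclideanSpace ℝ (Fin 3), (gaussianKernel u ‖k‖ : ℂ) *
      Complex.exp (Complex.I * ((⟪k, x⟫ : ℝ) : ℂ)) = ((2 * (u ^ 3)⁻¹ : ℝ) : ℂ) *
      Complex.exp (-(((u ^ 2)⁻¹ : ℝ) : ℂ) * (‖k‖ : ℂ) ^ 2 + Complex.I * ((⟪x, k⟫ : ℝ) : ℂ)) := by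
    intro k
    rw [gaussianKernel, Complex.exp_add, real_inner_comm]
    push_cast
    ring
  simp_rw [hfun]
  rw [integral_const_mul, h]
  have hexp : Complex.I ^ 2 * (‖x‖ : ℂ) ^ 2 / (4 * (((u ^ 2)⁻¹ : ℝ) : ℂ)) =
      ((-(‖x‖ / 2 * u) ^ 2 : ℝ) : ℂ) := by
    have : (u : ℂ) ≠ 0 := by exact_mod_cast hu.ne'
    push_cast
    rw [Complex.I_sq]
    field_simp
    ring
  rw [hexp, ← Complex.ofReal_exp, ← Complex.ofReal_mul, ← Complex.ofReal_mul]
  congr 1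
  field_simp

theorem integral_gaussianKernel_norm {u : ℝ} (hu : 0 < u) :
    ∫ k : EuclideanSpace ℝ (Fin 3), gaussianKernel u ‖k‖ = 2 * Real.sqrt Real.pi ^ 3 := by
  have h := integral_gaussianKernel_norm_mul_cexp hu 0
  simp only [inner_zero_right, Complex.ofReal_zero, mul_zero, Complex.exp_zero, mul_one,
    norm_zero, zero_div, zero_mul, integral_complex_ofReal] at h
  simpa using Complex.ofReal_injective h

theorem measurable_uncurry_gaussianKernel_norm : Measurable
    (fun p : ℝ × EuclideanSpace ℝ (Fin 3) => gaussianKernel p.1 ‖p.2‖) := by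
  unfold gaussianKernel
  fun_prop

theorem integrable_prod_gaussianKernel_norm (a : ℝ) : Integrable
    (fun p : ℝ × EuclideanSpace ℝ (Fin 3) => gaussianKernel p.1 ‖p.2‖)
    ((volume.restrict (Set.Ioc 0 a)).prod volume) := by
  rw [integrable_prod_iff measurable_uncurry_gaussianKernel_norm.aestronglyMeasurable]
  have hpos : ∀ᵐ u ∂(volume.restrict (Set.Ioc 0 a)), 0 < u :=
    (ae_restrict_mem measurableSet_Ioc).mono fun u hu => hu.1
  refine ⟨hpos.mono fun u hu => integrable_gaussianKernel_norm hu, ?_⟩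
  refine (integrable_const (2 * Real.sqrt Real.pi ^ 3)).congr (hpos.mono fun u hu => ?_)
  simp only [Real.norm_of_nonneg (gaussianKernel_nonneg hu _), integral_gaussianKernel_norm hu]

theorem integrable_prod_gaussianKernel_norm_mul_cexp (a : ℝ) (x : EuclideanSpace ℝ (Fin 3)) :
    Integrable (fun p : ℝ × EuclideanSpace ℝ (Fin 3) =>
      (gaussianKernel p.1 ‖p.2‖ : ℂ) * Complex.exp (Complex.I * ((⟪p.2, x⟫ : ℝ) : ℂ)))
    ((volume.restrict (Set.Ioc 0 a)).prod volume) := by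
  refine (integrable_prod_gaussianKernel_norm a).mono ?_ (.of_forall fun p => ?_)
  · refine Measurable.aestronglyMeasurable ?_
    have := measurable_uncurry_gaussianKernel_norm
    fun_prop
  · rw [norm_mul, mul_comm Complex.I, Complex.norm_exp_ofReal_mul_I, mul_one, Complex.norm_real]

theorem integral_gaussianKernel {a r : ℝ} (ha : 0 < a) (hr : 0 < r)
    (hInt : IntegrableOn (fun u => gaussianKernel u r) (Set.Ioc 0 a)) :
    ∫ u in Set.Ioc 0 a, gaussianKernel u r = Real.exp (-(a ^ 2)⁻¹ * r ^ 2) / r ^ 2 := by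
  have hderiv : ∀ u : ℝ, 0 < u →
      HasDerivAt (fun u => Real.exp (-(u ^ 2)⁻¹ * r ^ 2) / r ^ 2) (gaussianKernel u r) u := by
    intro u hu
    have h := (((((hasDerivAt_pow 2 u).inv (by positivity)).neg).mul_const (r ^ 2)).exp).div_const
      (r ^ 2)
    refine h.congr_deriv ?_
    simp only [gaussianKernel, Pi.neg_apply, Pi.inv_apply]
    field_simp
    norm_num [mul_comm]
  have hzero : Filter.Tendsto (fun u : ℝ => Real.exp (-(u ^ 2)⁻¹ * r ^ 2) / r ^ 2)
      (nhdsWithin 0 (Set.Ioi 0)) (nhds 0) := by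
    rw [show nhds (0 : ℝ) = nhds (0 / r ^ 2) by rw [zero_div]]
    refine (Real.tendsto_exp_atBot.comp ?_).div_const _
    refine Filter.Tendsto.atBot_mul_const (by positivity) ?_
    refine Filter.tendsto_neg_atTop_atBot.comp ?_
    simp_rw [← inv_pow]
    exact (Filter.tendsto_pow_atTop two_ne_zero).comp tendsto_inv_nhdsGT_zero
  rw [← intervalIntegral.integral_of_le ha.le,
    intervalIntegral.integral_eq_sub_of_hasDerivAt_of_tendsto ha (fun u hu => hderiv u hu.1)
      ((intervalIntegrable_iff_integrableOn_Ioc_of_le ha.le).2 hInt) hzero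
      ((hderiv a ha).continuousAt.tendsto.mono_left nhdsWithin_le_nhds), sub_zero]

theorem ae_integral_gaussianKernel_norm {a : ℝ} (ha : 0 < a) :
    ∀ᵐ k : EuclideanSpace ℝ (Fin 3), ∫ u in Set.Ioc 0 a, gaussianKernel u ‖k‖ =
      Real.exp (-(a ^ 2)⁻¹ * ‖k‖ ^ 2) / ‖k‖ ^ 2 := by
  filter_upwards [(integrable_prod_gaussianKernel_norm a).prod_left_ae,
    compl_mem_ae_iff.2 (measure_singleton (0 : EuclideanSpace ℝ (Fin 3)))] with k hk hk0
  exact integral_gaussianKernel ha (norm_pos_iff.2 hk0) hk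

theorem integral_exp_neg_mul_sq_eq_erf {c : ℝ} (hc : 0 < c) (a : ℝ) :
    ∫ u in (0 : ℝ)..a, Real.exp (-(c * u) ^ 2) =
      Real.sqrt Real.pi / (2 * c) * Erf (c * a) := by
  rw [intervalIntegral.integral_comp_mul_left (fun t => Real.exp (-t ^ 2)) hc.ne', Erf]
  have : Real.sqrt Real.pi ≠ 0 := by positivity
  simp only [mul_zero, smul_eq_mul]
  field_simp

/-- first worked example of the paper, eq. (h3). For `ℓ > 0` and `x ≠ 0` in
ℝ³, `(2π)⁻³ ∫ (e^{−ℓ²‖k‖²}/‖k‖²) e^{i⟨k,x⟩} dk = Erf(‖x‖/(2ℓ)) / (4π‖x‖)`: the regularized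
Newtonian potential of a point mass in ghost-free infinite-derivative linearized gravity. -/
theorem regularized_newtonian_potential
    (ℓ : ℝ) (hℓ : 0 < ℓ) (x : EuclideanSpace ℝ (Fin 3)) (hx : x ≠ 0) :
    ((((2 * Real.pi) ^ 3)⁻¹ : ℝ) : ℂ) *
        ∫ k : EuclideanSpace ℝ (Fin 3),
          ((Real.exp (-(ℓ ^ 2) * ‖k‖ ^ 2) / ‖k‖ ^ 2 : ℝ) : ℂ) *
            Complex.exp (Complex.I * ((⟪k, x⟫ : ℝ) : ℂ)) =
      (((1 / (4 * Real.pi * ‖x‖)) * Erf (‖x‖ / (2 * ℓ)) : ℝ) : ℂ) := by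
  have ha : 0 < ℓ⁻¹ := inv_pos.2 hℓ
  have hx' : 0 < ‖x‖ := norm_pos_iff.2 hx
  have hfubini : ∫ k : EuclideanSpace ℝ (Fin 3),
      ((Real.exp (-(ℓ ^ 2) * ‖k‖ ^ 2) / ‖k‖ ^ 2 : ℝ) : ℂ) *
        Complex.exp (Complex.I * ((⟪k, x⟫ : ℝ) : ℂ)) =
      ∫ u in Set.Ioc 0 ℓ⁻¹, ∫ k : EuclideanSpace ℝ (Fin 3), (gaussianKernel u ‖k‖ : ℂ) *
        Complex.exp (Complex.I * ((⟪k, x⟫ : ℝ) : ℂ)) := by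
    rw [integral_integral_swap (integrable_prod_gaussianKernel_norm_mul_cexp ℓ⁻¹ x)]
    refine integral_congr_ae ((ae_integral_gaussianKernel_norm ha).mono fun k hk => ?_)
    simp only [integral_mul_const, integral_complex_ofReal, hk, inv_pow, inv_inv]
  rw [hfubini, setIntegral_congr_fun measurableSet_Ioc
    (fun u hu => integral_gaussianKernel_norm_mul_cexp hu.1 x), integral_complex_ofReal,
    ← intervalIntegral.integral_of_le ha.le, intervalIntegral.integral_const_mul,
    integral_exp_neg_mul_sq_eq_erf (half_pos hx'), ← Complex.ofReal_mul,
    show ‖x‖ / 2 * ℓ⁻¹ = ‖x‖ / (2 * ℓ) by field_simp]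
  congr 1
  have hpi : Real.sqrt Real.pi ^ 4 = Real.pi ^ 2 := by
    rw [show 4 = 2 * 2 from rfl, pow_mul, Real.sq_sqrt Real.pi_pos.le]
  field_simp
  rw [hpi]
  ring
end

section
/- Let ℓ > 0, let x ∈ ℝ³ with x ≠ 0, and let j ∈ {1, 2, 3}. Then (2π)⁻³ · ∫_{ℝ³} k_j · (exp(−ℓ²‖k‖²) / ‖k‖²) · exp(i⟨k, x⟩) dk = i · (x_j / (4π‖x‖³)) · ( Erf(‖x‖/(2ℓ)) − (‖x‖/(ℓ√π)) · exp(−‖x‖²/(4ℓ²)) ), where Erf(z) := (2/√π) ∫₀^z e^{−t²} dt, k_j and x_j denote the j-th Euclidean coordinates, the integral is a complex-valued Lebesgue integral (absolutely convergent), and ⟨·,·⟩ is the Euclidean inner product on ℝ³. -/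
open MeasureTheory RealInnerProductSpace

section GaussianMoments

variable {V : Type*} [NormedAddCommGroup V] [InnerProductSpace ℝ V]

theorem norm_cexp_neg_mul_sq_norm_add_I_mul_inner (b : ℝ) (k x : V) :
    ‖Complex.exp (-(b : ℂ) * (‖k‖ : ℂ) ^ 2 + Complex.I * ((⟪k, x⟫ : ℝ) : ℂ))‖ =
      Real.exp (-b * ‖k‖ ^ 2) := by
  rw [Complex.norm_exp]
  congr 1
  simp [← Complex.ofReal_pow]

theorem hasLineDerivAt_cexp_neg_mul_sq_norm_add_I_mul_inner (b : ℝ) (x v k : V) :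
    HasLineDerivAt ℝ
      (fun k : V ↦ Complex.exp (-(b : ℂ) * (‖k‖ : ℂ) ^ 2 + Complex.I * ((⟪k, x⟫ : ℝ) : ℂ)))
      ((-(2 * b : ℂ) * ((⟪v, k⟫ : ℝ) : ℂ) + Complex.I * ((⟪v, x⟫ : ℝ) : ℂ)) *
        Complex.exp (-(b : ℂ) * (‖k‖ : ℂ) ^ 2 + Complex.I * ((⟪k, x⟫ : ℝ) : ℂ))) k v := by
  have hline : HasDerivAt (fun t : ℝ ↦ k + t • v) v 0 := by
    simpa using ((hasDerivAt_id (0 : ℝ)).smul_const v).const_add k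
  have hsq : HasDerivAt (fun t : ℝ ↦ ‖k + t • v‖ ^ 2) (2 * ⟪v, k⟫) 0 := by
    simpa [real_inner_comm] using hline.norm_sq
  have hin : HasDerivAt (fun t : ℝ ↦ ⟪k + t • v, x⟫) ⟪v, x⟫ 0 := by
    simpa using hline.inner ℝ (hasDerivAt_const (0 : ℝ) x)
  have h := ((hsq.ofReal_comp.const_mul (-(b : ℂ))).add
    (hin.ofReal_comp.const_mul Complex.I)).cexp
  unfold HasLineDerivAt
  convert! h using 1
  · ext t; simp
  · simp; ring

variable [FiniteDimensional ℝ V] [MeasurableSpace V] [BorelSpace V]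

theorem integrable_norm_rpow_mul_exp_neg_mul_sq_norm [Nontrivial V] {b s : ℝ} (hb : 0 < b)
    (hs : -(Module.finrank ℝ V : ℝ) < s) :
    Integrable (fun k : V ↦ ‖k‖ ^ s * Real.exp (-b * ‖k‖ ^ 2)) := by
  rw [integrable_fun_norm_addHaar (volume : Measure V)
    (f := fun r : ℝ ↦ r ^ s * Real.exp (-b * r ^ 2))]
  have hn : 1 ≤ Module.finrank ℝ V := Module.finrank_pos
  refine (integrableOn_rpow_mul_exp_neg_mul_sq hb
    (s := ((Module.finrank ℝ V - 1 : ℕ) : ℝ) + s) ?_).congr_fun ?_ measurableSet_Ioi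
  · push_cast [hn]; linarith
  · intro r hr
    simp only [smul_eq_mul]
    rw [Real.rpow_add hr, Real.rpow_natCast, mul_assoc]

theorem integral_inner_mul_cexp_neg_mul_sq_norm_add [Nontrivial V] {b : ℝ} (hb : 0 < b)
    (x v : V) :
    ∫ k : V, ((⟪v, k⟫ : ℝ) : ℂ) *
        Complex.exp (-(b : ℂ) * (‖k‖ : ℂ) ^ 2 + Complex.I * ((⟪k, x⟫ : ℝ) : ℂ)) =
      Complex.I * ((⟪v, x⟫ / (2 * b) * (Real.pi / b) ^ (Module.finrank ℝ V / 2 : ℝ) *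
        Real.exp (-‖x‖ ^ 2 / (4 * b)) : ℝ) : ℂ) := by
  set E : V → ℂ := fun k ↦
    Complex.exp (-(b : ℂ) * (‖k‖ : ℂ) ^ 2 + Complex.I * ((⟪k, x⟫ : ℝ) : ℂ)) with hE
  have hEc : Continuous E := by fun_prop
  have hEn (k : V) : ‖E k‖ = Real.exp (-b * ‖k‖ ^ 2) :=
    norm_cexp_neg_mul_sq_norm_add_I_mul_inner b k x
  have hE1 : Integrable E := by
    refine (integrable_norm_rpow_mul_exp_neg_mul_sq_norm (V := V) hb (s := 0) ?_).mono'
      hEc.aestronglyMeasurable (.of_forall fun k ↦ ?_)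
    · simpa using Module.finrank_pos (R := ℝ) (M := V)
    · simp [hEn]
  have hE2 : Integrable (fun k ↦ ((⟪v, k⟫ : ℝ) : ℂ) * E k) := by
    refine ((integrable_norm_rpow_mul_exp_neg_mul_sq_norm (V := V) hb (s := 1) ?_).const_mul
      ‖v‖).mono' (by fun_prop) (.of_forall fun k ↦ ?_)
    · linarith [(Module.finrank ℝ V).cast_nonneg (α := ℝ)]
    · rw [norm_mul, hEn, Complex.norm_real, Real.rpow_one, ← mul_assoc]
      gcongr
      exact norm_inner_le_norm v k
  have hparts := integral_bilinear_hasLineDerivAt_right_eq_neg_left_of_integrable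
    (μ := (volume : Measure V)) (f := fun _ ↦ (1 : ℂ)) (f' := fun _ ↦ 0) (g := E) (v := v)
    (g' := fun k ↦ (-(2 * b : ℂ) * ((⟪v, k⟫ : ℝ) : ℂ) + Complex.I * ((⟪v, x⟫ : ℝ) : ℂ)) * E k)
    (B := ContinuousLinearMap.mul ℝ ℂ) (by simp)
    (by
      simp only [ContinuousLinearMap.mul_apply', one_mul, add_mul, mul_assoc (-(2 * b : ℂ))]
      exact (hE2.const_mul _).add (hE1.const_mul _))
    (by simpa using hE1) (fun k _ ↦ by simp [HasLineDerivAt, hasDerivAt_const])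
    (fun k _ ↦ hasLineDerivAt_cexp_neg_mul_sq_norm_add_I_mul_inner b x v k)
  have hgauss : ∫ k, E k = (((Real.pi / b) ^ (Module.finrank ℝ V / 2 : ℝ) *
      Real.exp (-‖x‖ ^ 2 / (4 * b)) : ℝ) : ℂ) := by
    have h := GaussianFourier.integral_cexp_neg_mul_sq_norm_add (V := V) (b := (b : ℂ))
      (by simpa using hb) Complex.I x
    simp only [hE, real_inner_comm x] at h ⊢
    rw [h, Complex.ofReal_mul, Complex.ofReal_cpow (by positivity)]
    push_cast
    simp
  simp only [ContinuousLinearMap.mul_apply', one_mul, zero_mul, integral_zero, neg_zero,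
    add_mul, mul_assoc (-(2 * b : ℂ))] at hparts
  rw [integral_add (hE2.const_mul _) (hE1.const_mul _), integral_const_mul, integral_const_mul,
    hgauss] at hparts
  have hbC : (b : ℂ) ≠ 0 := by exact_mod_cast hb.ne'
  have h2b : (2 * b : ℂ) * ∫ k, ((⟪v, k⟫ : ℝ) : ℂ) * E k = Complex.I * ((⟪v, x⟫ : ℝ) : ℂ) *
      (((Real.pi / b) ^ (Module.finrank ℝ V / 2 : ℝ) * Real.exp (-‖x‖ ^ 2 / (4 * b)) : ℝ) : ℂ) := by
    linear_combination -hparts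
  refine mul_left_cancel₀ (mul_ne_zero two_ne_zero hbC) (h2b.trans ?_)
  rw [mul_assoc (⟪v, x⟫ / (2 * b)), Complex.ofReal_mul (⟪v, x⟫ / (2 * b))]
  push_cast
  field_simp

end GaussianMoments

theorem integral_Ioi_exp_neg_mul_sq {r : ℝ} (hr : r ≠ 0) (a : ℝ) :
    ∫ b in Set.Ioi a, Real.exp (-b * r ^ 2) = Real.exp (-a * r ^ 2) / r ^ 2 := by
  have h := integral_exp_mul_Ioi (a := -r ^ 2) (by simpa using sq_pos_of_ne_zero hr) a
  simp only [neg_div_neg_eq] at h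
  convert h using 3 <;> ring_nf

theorem hasDerivAt_Erf (z : ℝ) :
    HasDerivAt Erf (2 / Real.sqrt Real.pi * Real.exp (-z ^ 2)) z := by
  have hc : Continuous fun t : ℝ ↦ Real.exp (-t ^ 2) := by fun_prop
  exact (intervalIntegral.integral_hasDerivAt_right (hc.intervalIntegrable _ _)
    (hc.stronglyMeasurableAtFilter _ _) hc.continuousAt).const_mul _

theorem hasDerivAt_Erf_sub_mul_exp (u : ℝ) :
    HasDerivAt (fun u ↦ Erf u - 2 / Real.sqrt Real.pi * (u * Real.exp (-u ^ 2)))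
      (4 / Real.sqrt Real.pi * u ^ 2 * Real.exp (-u ^ 2)) u := by
  have h := (hasDerivAt_Erf u).sub (((hasDerivAt_id u).mul
    ((hasDerivAt_id u).pow 2).neg.exp).const_mul (2 / Real.sqrt Real.pi))
  convert! h using 1
  simp
  ring

theorem integral_Ioi_rpow_mul_exp_neg_div {r a : ℝ} (hr : 0 < r) (ha : 0 < a) :
    ∫ b in Set.Ioi a, b ^ (-5 / 2 : ℝ) * Real.exp (-r ^ 2 / (4 * b)) =
      4 * Real.sqrt Real.pi / r ^ 3 * (Erf (r / (2 * Real.sqrt a)) -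
        2 / Real.sqrt Real.pi *
          (r / (2 * Real.sqrt a) * Real.exp (-(r / (2 * Real.sqrt a)) ^ 2))) := by
  set F : ℝ → ℝ := fun u ↦ Erf u - 2 / Real.sqrt Real.pi * (u * Real.exp (-u ^ 2)) with hF
  have hderiv (b : ℝ) (hb : b ∈ Set.Ici a) :
      HasDerivAt (fun b ↦ -(4 * Real.sqrt Real.pi / r ^ 3 * F (r / (2 * Real.sqrt b))))
        (b ^ (-5 / 2 : ℝ) * Real.exp (-r ^ 2 / (4 * b))) b := by
    have hb0 : 0 < b := ha.trans_le hb
    have hs : 0 < Real.sqrt b := Real.sqrt_pos.2 hb0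
    have hsq : Real.sqrt b ^ 2 = b := Real.sq_sqrt hb0.le
    have hu := (((Real.hasDerivAt_sqrt hb0.ne').const_mul 2).fun_inv (by positivity)).const_mul r
    simp only [← div_eq_mul_inv] at hu
    have h := (((hasDerivAt_Erf_sub_mul_exp (r / (2 * Real.sqrt b))).comp b hu).const_mul
      (4 * Real.sqrt Real.pi / r ^ 3)).neg
    convert! h using 1
    have hexp : -(r / (2 * Real.sqrt b)) ^ 2 = -r ^ 2 / (4 * b) := by
      rw [div_pow, mul_pow, hsq]; ring
    have hpow : b ^ (-5 / 2 : ℝ) = (Real.sqrt b ^ 5)⁻¹ := by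
      rw [Real.sqrt_eq_rpow, ← Real.rpow_natCast, ← Real.rpow_mul hb0.le, ← Real.rpow_neg hb0.le]
      norm_num
    rw [hexp, hpow]
    field_simp
    norm_num
  have hlim : Filter.Tendsto
      (fun b ↦ -(4 * Real.sqrt Real.pi / r ^ 3 * F (r / (2 * Real.sqrt b)))) Filter.atTop
      (nhds 0) := by
    have hu : Filter.Tendsto (fun b ↦ r / (2 * Real.sqrt b)) Filter.atTop (nhds 0) :=
      (Real.tendsto_sqrt_atTop.const_mul_atTop two_pos).const_div_atTop r
    have hF0 : F 0 = 0 := by simp [hF, Erf]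
    have h := (((hasDerivAt_Erf_sub_mul_exp 0).continuousAt.tendsto.comp hu).const_mul
      (4 * Real.sqrt Real.pi / r ^ 3)).neg
    change Filter.Tendsto _ _ (nhds (-(_ * F 0))) at h
    simpa [hF0] using h
  rw [integral_Ioi_of_hasDerivAt_of_nonneg' hderiv (fun b hb ↦ ?_) hlim]
  · ring
  · have : 0 < b := ha.trans hb
    positivity

/-- eq. (hfd) of the paper, third example: spinning semi-infinite cosmic
string. For `ℓ > 0`, `x ≠ 0` in ℝ³ and a coordinate index `j`,
`(2π)⁻³ ∫ k_j (e^{−ℓ²‖k‖²}/‖k‖²) e^{i⟨k,x⟩} dk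
  = i (x_j/(4π‖x‖³)) (Erf(‖x‖/2ℓ) − (‖x‖/(ℓ√π)) e^{−‖x‖²/(4ℓ²)})`. -/
theorem regularized_potential_gradient_fourier
    (ℓ : ℝ) (hℓ : 0 < ℓ) (x : EuclideanSpace ℝ (Fin 3)) (hx : x ≠ 0) (j : Fin 3) :
    ((((2 * Real.pi) ^ 3)⁻¹ : ℝ) : ℂ) *
        ∫ k : EuclideanSpace ℝ (Fin 3),
          ((k j : ℝ) : ℂ) * ((Real.exp (-(ℓ ^ 2) * ‖k‖ ^ 2) / ‖k‖ ^ 2 : ℝ) : ℂ) *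
            Complex.exp (Complex.I * ((⟪k, x⟫ : ℝ) : ℂ)) =
      Complex.I * (((x j / (4 * Real.pi * ‖x‖ ^ 3)) *
        (Erf (‖x‖ / (2 * ℓ)) -
          (‖x‖ / (ℓ * Real.sqrt Real.pi)) * Real.exp (-‖x‖ ^ 2 / (4 * ℓ ^ 2))) : ℝ) : ℂ) := by
  have hr : 0 < ‖x‖ := norm_pos_iff.2 hx
  have hℓ2 : 0 < ℓ ^ 2 := by positivity
  set f : EuclideanSpace ℝ (Fin 3) → ℝ → ℂ := fun k b ↦ ((k j : ℝ) : ℂ) *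
    Complex.exp (-(b : ℂ) * (‖k‖ : ℂ) ^ 2 + Complex.I * ((⟪k, x⟫ : ℝ) : ℂ)) with hf
  have hsplit (k : EuclideanSpace ℝ (Fin 3)) (b : ℝ) : f k b =
      ((k j : ℝ) : ℂ) * Complex.exp (Complex.I * ((⟪k, x⟫ : ℝ) : ℂ)) *
        ((Real.exp (-b * ‖k‖ ^ 2) : ℝ) : ℂ) := by
    simp only [hf, Complex.exp_add]; push_cast; ring
  have hfn (k : EuclideanSpace ℝ (Fin 3)) (b : ℝ) : ‖f k b‖ = ‖k j‖ * Real.exp (-b * ‖k‖ ^ 2) := by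
    rw [hf, norm_mul, norm_cexp_neg_mul_sq_norm_add_I_mul_inner, Complex.norm_real]
  have hne : ∀ᵐ k : EuclideanSpace ℝ (Fin 3), k ≠ 0 := by
    simp [ae_iff]
  have hint : Integrable (Function.uncurry f)
      ((volume : Measure (EuclideanSpace ℝ (Fin 3))).prod (volume.restrict (Set.Ioi (ℓ ^ 2)))) := by
    have hcont : Continuous (Function.uncurry f) := by
      simp only [hf, Function.uncurry_def]
      fun_prop
    rw [integrable_prod_iff hcont.aestronglyMeasurable]
    constructor
    · filter_upwards [hne] with k hk
      simp only [Function.uncurry_apply_pair, hsplit]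
      refine (Integrable.ofReal ?_).const_mul _
      have := integrableOn_exp_mul_Ioi (a := -‖k‖ ^ 2)
        (neg_neg_of_pos (by have := norm_pos_iff.2 hk; positivity)) (ℓ ^ 2)
      exact this.congr (.of_forall fun b ↦ congrArg Real.exp (by ring))
    · simp only [Function.uncurry_apply_pair, hfn, integral_const_mul]
      refine (integrable_norm_rpow_mul_exp_neg_mul_sq_norm hℓ2 (s := -1)
        (by norm_num)).mono' ?_ ?_
      · have hmeas := (hcont.aestronglyMeasurable (μ :=
          (volume : Measure (EuclideanSpace ℝ (Fin 3))).prod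
            (volume.restrict (Set.Ioi (ℓ ^ 2))))).norm.integral_prod_right'
        simpa only [Function.uncurry_apply_pair, hfn, integral_const_mul] using hmeas
      · filter_upwards [hne] with k hk
        have hk0 : 0 < ‖k‖ := norm_pos_iff.2 hk
        rw [integral_Ioi_exp_neg_mul_sq hk0.ne', Real.norm_of_nonneg (by positivity),
          Real.rpow_neg_one]
        calc ‖k j‖ * (Real.exp (-ℓ ^ 2 * ‖k‖ ^ 2) / ‖k‖ ^ 2)
            ≤ ‖k‖ * (Real.exp (-ℓ ^ 2 * ‖k‖ ^ 2) / ‖k‖ ^ 2) := by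
              gcongr; exact PiLp.norm_apply_le k j
          _ = ‖k‖⁻¹ * Real.exp (-ℓ ^ 2 * ‖k‖ ^ 2) := by field_simp
  have hleft : ∀ᵐ k : EuclideanSpace ℝ (Fin 3), ((k j : ℝ) : ℂ) *
      ((Real.exp (-(ℓ ^ 2) * ‖k‖ ^ 2) / ‖k‖ ^ 2 : ℝ) : ℂ) *
        Complex.exp (Complex.I * ((⟪k, x⟫ : ℝ) : ℂ)) = ∫ b in Set.Ioi (ℓ ^ 2), f k b := by
    filter_upwards [hne] with k hk
    simp only [hsplit]
    rw [integral_const_mul, integral_complex_ofReal,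
      integral_Ioi_exp_neg_mul_sq (norm_ne_zero_iff.2 hk)]
    ring
  have hinner : ∀ b ∈ Set.Ioi (ℓ ^ 2), ∫ k, f k b = Complex.I *
      ((x j / 2 * (Real.pi * Real.sqrt Real.pi) *
        (b ^ (-5 / 2 : ℝ) * Real.exp (-‖x‖ ^ 2 / (4 * b))) : ℝ) : ℂ) := by
    intro b hb
    have hb0 : 0 < b := hℓ2.trans hb
    have h := integral_inner_mul_cexp_neg_mul_sq_norm_add hb0 x (EuclideanSpace.single j (1 : ℝ))
    simp only [EuclideanSpace.inner_single_left, map_one, one_mul, finrank_euclideanSpace,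
      Fintype.card_fin] at h
    rw [h]
    congr 2
    have hpow : (Real.pi / b) ^ ((3 : ℕ) / 2 : ℝ) =
        Real.pi * Real.sqrt Real.pi * (b * b ^ (-5 / 2 : ℝ)) := by
      rw [Real.div_rpow Real.pi_pos.le hb0.le, Real.sqrt_eq_rpow, ← Real.rpow_one_add'
        Real.pi_pos.le (by norm_num), ← Real.rpow_one_add' hb0.le (by norm_num), div_eq_mul_inv,
        ← Real.rpow_neg hb0.le]
      norm_num
    rw [hpow]
    field_simp
  rw [integral_congr_ae hleft, integral_integral_swap hint,
    setIntegral_congr_fun measurableSet_Ioi hinner, integral_const_mul, integral_complex_ofReal,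
    integral_const_mul, integral_Ioi_rpow_mul_exp_neg_div hr hℓ2, Real.sqrt_sq hℓ.le,
    mul_left_comm, ← Complex.ofReal_mul]
  congr 2
  have hexp : -(‖x‖ / (2 * ℓ)) ^ 2 = -‖x‖ ^ 2 / (4 * ℓ ^ 2) := by
    rw [div_pow, mul_pow]; ring
  have hpi : Real.sqrt Real.pi ^ 2 = Real.pi := Real.sq_sqrt Real.pi_pos.le
  rw [hexp]
  field_simp
  rw [hpi]
  ring
end
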